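/- There exist absolute constants c > 0 (c = 2^{−13}/100 suffices) and C, C' such that the following holds. Let N be an odd positive integer, G = ℤ/Nℤ, let B be a regular Bohr set, and let A ⊆ B have relative density α > 0. Let B¹, B² be regular Bohr sets of rank d with B² ⊂_{c/d} B¹, and suppose that for some integer p ≥ 1, ‖μ_A∘μ_A‖_{p(μ_{B¹}∘μ_{B¹}∗μ_{B²}∘μ_{B²})} ≥ (1 + 2^{−5})·μ(B)^{−1}. Then there is a parameter σ ∈ [1 + 2^{−7}, α^{−1}], regular Bohr sets B', B'', a translate t ∈ G, and nonempty subsets A₁ ⊆ B', A₂ ⊆ B'' + t such that: (1) setting S = {x : μ_A∘μ_A(x) ≥ (1 − 2^{−10})·σ·μ(B)^{−1}}, one has ⟨μ_{A₁}∘μ_{A₂}, 1_S⟩ ≥ 1 − 2^{−12}; (2) the relative density of A₁ in B' and the relative density of A₂ in B'' + t are each at least α^{p + C·L(α)}; (3) B' = B¹_δ for some δ ≥ (c/(2d))^{C'·log σ}, and B'' ⊂_{c/d} B'; (4) for each i ∈ {1,2}, ⟨μ_A∘μ_A, μ_{A_i}∘μ_{A_i}⟩ ≤ 2^{8}·σ·μ(B)^{−1}.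 -/

import Mathlib

open Finset BigOperators Pointwise
open scoped Classical

namespace Formal

variable {G : Type*} [AddCommGroup G] [Fintype G]

/-- `ex f = 𝔼_{x ∈ G} f x`. -/
noncomputable def ex (f : G → ℝ) : ℝ := (∑ x, f x) / (Fintype.card G : ℝ)

/-- `ip f g = ⟨f, g⟩ = 𝔼_x f x * g x`. -/
noncomputable def ip (f g : G → ℝ) : ℝ := ex (fun x => f x * g x)

/-- `ipWt ν f g = ⟨f, g⟩_ν = 𝔼_x f x * g x * ν x`. -/
noncomputable def ipWt (ν f g : G → ℝ) : ℝ := ex (fun x => f x * g x * ν x)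

/-- Convolution `f ∗ g (x) = 𝔼_y f y * g (x - y)`. -/
noncomputable def cv (f g : G → ℝ) : G → ℝ := fun x => ex (fun y => f y * g (x - y))

/-- Difference convolution `f ∘ g (x) = 𝔼_y f y * g (x + y)`. -/
noncomputable def dcv (f g : G → ℝ) : G → ℝ := fun x => ex (fun y => f y * g (x + y))

/-- Normalized indicator measure `μ_A = (|G|/|A|) · 1_A`. -/
noncomputable def mu (A : Set G) : G → ℝ :=
  fun x => if x ∈ A then (Fintype.card G : ℝ) / (Nat.card A : ℝ) else 0

/-- Density `|A|/|G|`. -/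
noncomputable def density (A : Set G) : ℝ := (Nat.card A : ℝ) / (Fintype.card G : ℝ)

/-- Relative density `|A|/|B|`. -/
noncomputable def relDensity (A B : Set G) : ℝ := (Nat.card A : ℝ) / (Nat.card B : ℝ)

/-- `‖f‖_p = (𝔼_x |f x|^p)^{1/p}`. -/
noncomputable def lpNorm (p : ℝ) (f : G → ℝ) : ℝ := (ex (fun x => |f x| ^ p)) ^ (1 / p)

/-- `‖f‖_{p(ν)} = (𝔼_x |f x|^p ν x)^{1/p}`. -/
noncomputable def lpNormWt (p : ℝ) (ν f : G → ℝ) : ℝ := (ex (fun x => |f x| ^ p * ν x)) ^ (1 / p)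

/-- `‖f‖_∞ = max_x |f x|`. -/
noncomputable def linftyNorm (f : G → ℝ) : ℝ := ⨆ x, |f x|

/-- `‖f‖_1 = 𝔼_x |f x|`. -/
noncomputable def l1Norm (f : G → ℝ) : ℝ := ex (fun x => |f x|)

/-- Indicator function of a set. -/
noncomputable def indic (S : Set G) : G → ℝ := fun x => if x ∈ S then 1 else 0

/-- `Lq α = log (2/α)`. -/
noncomputable def Lq (α : ℝ) : ℝ := Real.log (2 / α)

/-- `iterConv f k` is the `k`-fold convolution `f ∗ ⋯ ∗ f` (for `k ≥ 1`);
`iterConv f 0` is the convolution identity. -/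
noncomputable def iterConv (f : G → ℝ) : ℕ → G → ℝ
  | 0 => fun x => if x = 0 then (Fintype.card G : ℝ) else 0
  | n + 1 => cv (iterConv f n) f

/-- Fourier transform `f̂ γ = 𝔼_x f x * conj (γ x)`. -/
noncomputable def ft (f : G → ℝ) (γ : AddChar G ℂ) : ℂ :=
  (∑ x, (f x : ℂ) * (starRingEnd ℂ) (γ x)) / (Fintype.card G : ℝ)

/-- The large spectrum `Δ_{1/2}(X)` of the measure `μ_X`. -/
noncomputable def Delta (X : Set G) : Set (AddChar G ℂ) :=
  {γ | 1 / 2 ≤ ‖ft (mu X) γ‖}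

/-- A Bohr set: a finite set of characters together with a radius. -/
structure Bohr (G : Type*) [AddCommGroup G] where
  freq : Finset (AddChar G ℂ)
  radius : ℝ

namespace Bohr

variable {G : Type*} [AddCommGroup G]

/-- The underlying set `{x : |1 - γ x| ≤ ρ for all γ ∈ Λ}` of a Bohr set. -/
def carrier (B : Bohr G) : Set G := {x | ∀ γ ∈ B.freq, ‖(1 : ℂ) - γ x‖ ≤ B.radius}

/-- The rank `|Λ|` of a Bohr set. -/
def rank (B : Bohr G) : ℕ := B.freq.card

/-- The dilate `B_δ` of a Bohr set. -/
def dilate (B : Bohr G) (δ : ℝ) : Bohr G := ⟨B.freq, δ * B.radius⟩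

/-- A Bohr set of rank `d` is regular if for all `|κ| ≤ 1/(100d)`,
`(1 - 100d|κ|)|B| ≤ |B_{1+κ}| ≤ (1 + 100d|κ|)|B|`. -/
def Regular (B : Bohr G) : Prop :=
  ∀ κ : ℝ, |κ| ≤ 1 / (100 * B.rank) →
    (1 - 100 * B.rank * |κ|) * (Nat.card B.carrier : ℝ) ≤
        (Nat.card ((B.dilate (1 + κ)).carrier) : ℝ) ∧
    (Nat.card ((B.dilate (1 + κ)).carrier) : ℝ) ≤
        (1 + 100 * B.rank * |κ|) * (Nat.card B.carrier : ℝ)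

/-- `B' ⊂_r B` : `B'` is a regular dilate `B_δ` of `B` with `δ ∈ [r/2, r]`. -/
def subR (r : ℝ) (B' B : Bohr G) : Prop :=
  ∃ δ : ℝ, r / 2 ≤ δ ∧ δ ≤ r ∧ B' = B.dilate δ ∧ B'.Regular

/-- The density `μ(B) = |B|/|G|` of a Bohr set. -/
noncomputable def dens (B : Bohr G) : ℝ := (Nat.card B.carrier : ℝ) / (Nat.card G : ℝ)

end Bohr


/-! ### Sifting for finite sets -/

/-- The number of representations of `z` as a difference of two elements of `A`. -/
noncomputable def diffCount (A : Finset G) (z : G) : ℝ :=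
  ∑ u, (if u ∈ A then 1 else 0) * (if z + u ∈ A then (1 : ℝ) else 0)

/-- The sum of `h (y - x)` over pairs in `X × Y`. -/
noncomputable def pairSum (X Y : Finset G) (h : G → ℝ) : ℝ := ∑ x ∈ X, ∑ y ∈ Y, h (y - x)

/-- The average of `h (y - x)` over pairs in `X × Y`. -/
noncomputable def pairAvg (X Y : Finset G) (h : G → ℝ) : ℝ := pairSum X Y h / (#X * #Y)

/-- The elements of `X` all of whose translates by the `s i` lie in `A`. -/
noncomputable def sift (A X : Finset G) {k : ℕ} (s : Fin k → G) : Finset G :=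
  X.filter fun x => ∀ i, x + s i ∈ A

lemma diffCount_nonneg (A : Finset G) (z : G) : 0 ≤ diffCount A z :=
  Finset.sum_nonneg fun u _ => by split_ifs <;> simp

lemma diffCount_le (A : Finset G) (z : G) : diffCount A z ≤ #A := by
  calc diffCount A z ≤ ∑ u, (if u ∈ A then (1 : ℝ) else 0) := by
        refine Finset.sum_le_sum fun u _ => ?_
        split_ifs <;> simp
    _ = #A := by simp

lemma sum_add_mem_mul (A : Finset G) (x y : G) :
    ∑ u, (if x + u ∈ A then (1 : ℝ) else 0) * (if y + u ∈ A then 1 else 0) =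
      diffCount A (y - x) := by
  unfold diffCount
  refine Fintype.sum_equiv (Equiv.addLeft x) _ _ fun u => ?_
  rw [Equiv.coe_addLeft, show y - x + (x + u) = y + u by abel]

lemma prod_ite_mem (A : Finset G) {k : ℕ} (s : Fin k → G) (x : G) :
    (if ∀ i, x + s i ∈ A then (1 : ℝ) else 0) = ∏ i, if x + s i ∈ A then (1 : ℝ) else 0 := by
  rw [Finset.prod_ite_zero]
  simp

lemma sum_pairSum_sift (A X Y : Finset G) (k : ℕ) (h : G → ℝ) :
    ∑ s : Fin k → G, pairSum (sift A X s) (sift A Y s) h =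
      pairSum X Y fun z => diffCount A z ^ k * h z := by
  have key : ∀ s : Fin k → G, pairSum (sift A X s) (sift A Y s) h =
      ∑ x ∈ X, ∑ y ∈ Y, (∏ i, (if x + s i ∈ A then (1 : ℝ) else 0) *
        (if y + s i ∈ A then 1 else 0)) * h (y - x) := by
    intro s
    unfold pairSum sift
    rw [Finset.sum_filter]
    refine Finset.sum_congr rfl fun x _ => ?_
    rw [Finset.sum_filter]
    split_ifs with hx
    · refine Finset.sum_congr rfl fun y _ => ?_
      rw [Finset.prod_mul_distrib, ← prod_ite_mem, ← prod_ite_mem]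
      simp [hx]
    · symm
      refine Finset.sum_eq_zero fun y _ => ?_
      rw [Finset.prod_mul_distrib, ← prod_ite_mem]
      simp [hx]
  simp_rw [key]
  rw [Finset.sum_comm]
  refine Finset.sum_congr rfl fun x _ => ?_
  rw [Finset.sum_comm]
  refine Finset.sum_congr rfl fun y _ => ?_
  simp only [← Finset.sum_mul, ← sum_add_mem_mul, Fintype.sum_pow]

lemma sum_card_sift (A X : Finset G) (k : ℕ) :
    ∑ s : Fin k → G, (#(sift A X s) : ℝ) = #X * (#A : ℝ) ^ k := by
  have key : ∀ s : Fin k → G, (#(sift A X s) : ℝ) =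
      ∑ x ∈ X, ∏ i, (if x + s i ∈ A then (1 : ℝ) else 0) := by
    intro s
    simp_rw [← prod_ite_mem]
    simp [sift]
  simp_rw [key]
  rw [Finset.sum_comm]
  have : ∀ x : G, ∑ u, (if x + u ∈ A then (1 : ℝ) else 0) = #A := by
    intro x
    rw [Fintype.sum_equiv (Equiv.addLeft x) _ (fun u => if u ∈ A then (1 : ℝ) else 0)
      (fun u => by rw [Equiv.coe_addLeft])]
    simp
  have hpow : ∀ x : G, ∑ s : Fin k → G, ∏ i, (if x + s i ∈ A then (1 : ℝ) else 0) =
      (#A : ℝ) ^ k := by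
    intro x
    rw [← this x, Fintype.sum_pow]
  simp only [hpow, Finset.sum_const, nsmul_eq_mul]

lemma pairSum_le (X Y : Finset G) {h g : G → ℝ} (H : ∀ z, h z ≤ g z) :
    pairSum X Y h ≤ pairSum X Y g :=
  Finset.sum_le_sum fun _ _ => Finset.sum_le_sum fun _ _ => H _

lemma pairSum_add (X Y : Finset G) (h g : G → ℝ) :
    pairSum X Y (fun z => h z + g z) = pairSum X Y h + pairSum X Y g := by
  simp [pairSum, Finset.sum_add_distrib]

lemma pairSum_mul (X Y : Finset G) (c : ℝ) (h : G → ℝ) :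
    pairSum X Y (fun z => c * h z) = c * pairSum X Y h := by
  simp [pairSum, Finset.mul_sum]

lemma pairSum_const (X Y : Finset G) (c : ℝ) :
    pairSum X Y (fun _ => c) = c * (#X * #Y) := by
  simp [pairSum]; ring

lemma pairAvg_le (X Y : Finset G) {h g : G → ℝ} (H : ∀ z, h z ≤ g z) :
    pairAvg X Y h ≤ pairAvg X Y g :=
  div_le_div_of_nonneg_right (pairSum_le X Y H) (by positivity)

lemma pairAvg_add (X Y : Finset G) (h g : G → ℝ) :
    pairAvg X Y (fun z => h z + g z) = pairAvg X Y h + pairAvg X Y g := by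
  simp [pairAvg, pairSum_add, add_div]

lemma pairAvg_mul (X Y : Finset G) (c : ℝ) (h : G → ℝ) :
    pairAvg X Y (fun z => c * h z) = c * pairAvg X Y h := by
  simp [pairAvg, pairSum_mul, mul_div_assoc]

lemma pairAvg_const {X Y : Finset G} (hX : X.Nonempty) (hY : Y.Nonempty) (c : ℝ) :
    pairAvg X Y (fun _ => c) = c := by
  have h1 : (#X : ℝ) ≠ 0 := by simpa using hX.ne_empty
  have h2 : (#Y : ℝ) ≠ 0 := by simpa using hY.ne_empty
  rw [pairAvg, pairSum_const]
  field_simp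

lemma pow_pairAvg_le {X : Finset G} (hX : X.Nonempty) {F : G → ℝ} (hF : ∀ z, 0 ≤ F z) (k : ℕ) :
    pairAvg X X F ^ k ≤ pairAvg X X fun z => F z ^ k := by
  have h1 : (#X : ℝ) ≠ 0 := by simpa using hX.ne_empty
  have := Real.pow_arith_mean_le_arith_mean_pow (X ×ˢ X) (fun _ => 1 / ((#X : ℝ) * #X))
    (fun q => F (q.2 - q.1)) (fun _ _ => by positivity)
    (by simp; field_simp) (fun _ _ => hF _) k
  simpa [pairAvg, pairSum, Finset.sum_product, ← Finset.mul_sum, div_eq_inv_mul] using this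

/-- If the average of `h` over `X × X`, weighted by the number of sifts, is large, then some sifted
subset of `X` is dense and has a positive average of `h`. -/
lemma exists_sift {A X : Finset G} {k : ℕ} {h : G → ℝ} {H η : ℝ} (hH : 0 ≤ H) (hη : 0 ≤ η)
    (hh : ∀ z, h z ≤ H)
    (hlt : H * η * (#X * #X) * (#A : ℝ) ^ k < pairSum X X fun z => diffCount A z ^ k * h z) :
    ∃ Y ⊆ X, Y.Nonempty ∧ η * #X ≤ #Y ∧ 0 < pairSum Y Y h := by
  by_contra! hcon
  rw [← sum_pairSum_sift] at hlt
  refine absurd hlt (not_lt.2 ?_)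
  calc ∑ s : Fin k → G, pairSum (sift A X s) (sift A X s) h
      ≤ ∑ s : Fin k → G, H * η * #X * #(sift A X s) := by
        refine Finset.sum_le_sum fun s _ => ?_
        rcases (sift A X s).eq_empty_or_nonempty with he | hne
        · simp [he, pairSum]
        rcases le_or_gt (η * #X) (#(sift A X s) : ℝ) with hb | hb
        · exact (hcon _ (Finset.filter_subset _ _) hne hb).trans (by positivity)
        · calc pairSum (sift A X s) (sift A X s) h
              ≤ pairSum (sift A X s) (sift A X s) fun _ => H := pairSum_le _ _ hh
            _ = H * #(sift A X s) * #(sift A X s) := by rw [pairSum_const]; ring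
            _ ≤ H * #(sift A X s) * (η * #X) := by gcongr
            _ = _ := by ring
    _ = H * η * (#X * #X) * (#A : ℝ) ^ k := by rw [← Finset.mul_sum, sum_card_sift]; ring

/-- The difference convolution of `A`, normalised relative to a superset of relative density `α`. -/
noncomputable def normDiff (A : Finset G) (α : ℝ) (z : G) : ℝ := diffCount A z / (α * #A)

section Steps

variable {A : Finset G} {α : ℝ}

lemma normDiff_nonneg (hα : 0 < α) (z : G) : 0 ≤ normDiff A α z :=
  div_nonneg (diffCount_nonneg A z) (by positivity)

lemma normDiff_le (hA : A.Nonempty) (hα : 0 < α) (z : G) : normDiff A α z ≤ 1 / α := by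
  have h1 : (0 : ℝ) < #A := by exact_mod_cast hA.card_pos
  rw [normDiff, div_le_div_iff₀ (by positivity) hα]
  nlinarith [diffCount_le A z]

lemma exists_sift_normDiff (hA : A.Nonempty) (hα : 0 < α) {X : Finset G} (hX : X.Nonempty) {k : ℕ}
    {h : G → ℝ} {H η : ℝ} (hH : 0 ≤ H) (hη : 0 ≤ η) (hh : ∀ z, h z ≤ H)
    (hlt : H * η < α ^ k * pairAvg X X fun z => normDiff A α z ^ k * h z) :
    ∃ Y ⊆ X, Y.Nonempty ∧ η * #X ≤ #Y ∧ 0 < pairAvg Y Y h := by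
  have h1 : (0 : ℝ) < #A := by exact_mod_cast hA.card_pos
  have h2 : (0 : ℝ) < #X := by exact_mod_cast hX.card_pos
  obtain ⟨Y, hYX, hY, hc, hp⟩ := exists_sift (A := A) (X := X) (k := k) hH hη hh (by
    have e : (fun z => diffCount A z ^ k * h z) =
        fun z => (α * #A) ^ k * (normDiff A α z ^ k * h z) := by
      funext z
      rw [normDiff, div_pow]
      field_simp
    rw [e, pairSum_mul, mul_pow]
    rw [pairAvg, ← mul_div_assoc, lt_div_iff₀ (by positivity)] at hlt
    have := mul_lt_mul_of_pos_right hlt (pow_pos h1 k)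
    linarith)
  have h3 : (0 : ℝ) < #Y := by exact_mod_cast hY.card_pos
  exact ⟨Y, hYX, hY, hc, by unfold pairAvg; positivity⟩

lemma pairAvg_sub_const {Y : Finset G} (hY : Y.Nonempty) (F : G → ℝ) (c : ℝ) :
    pairAvg Y Y (fun z => F z - c) = pairAvg Y Y F - c := by
  simp_rw [sub_eq_add_neg]
  rw [pairAvg_add, pairAvg_const hY hY]

/-- If the ratio of consecutive moments is at least `θ + e` then some sifted set has average
greater than `θ`. -/
lemma exists_sift_of_ratio (hA : A.Nonempty) (hα : 0 < α) {X : Finset G} (hX : X.Nonempty) {k : ℕ}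
    {θ η : ℝ} (hθ : 0 ≤ θ) (hη : 0 ≤ η)
    (hlt : η < α ^ (k + 1) * ((pairAvg X X fun z => normDiff A α z ^ (k + 1)) -
      θ * pairAvg X X fun z => normDiff A α z ^ k)) :
    ∃ Y ⊆ X, Y.Nonempty ∧ η * #X ≤ #Y ∧ θ < pairAvg Y Y (normDiff A α) := by
  obtain ⟨Y, hYX, hY, hc, hp⟩ := exists_sift_normDiff hA hα hX (k := k) (H := 1 / α) (η := η)
    (h := fun z => normDiff A α z - θ) (by positivity) hη
    (fun z => by have := normDiff_le hA hα z; linarith) (by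
      have e : (fun z => normDiff A α z ^ k * (normDiff A α z - θ)) =
        fun z => normDiff A α z ^ (k + 1) + (-θ) * normDiff A α z ^ k := by
        funext z; ring
      rw [e, pairAvg_add, pairAvg_mul, one_div, inv_mul_lt_iff₀ hα]
      calc η < _ := hlt
        _ = _ := by ring)
  rw [pairAvg_sub_const hY] at hp
  exact ⟨Y, hYX, hY, hc, by linarith⟩

/-- A large `p`-th moment yields a dense subset with a large average. -/
lemma exists_sift_of_moment (hA : A.Nonempty) (hα : 0 < α) {X : Finset G} (hα1 : α ≤ 1)
    (hX : X.Nonempty) {p : ℕ} (hp : 1 ≤ p)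
    (hm : (33 / 32 : ℝ) ^ p ≤ pairAvg X X fun z => normDiff A α z ^ p) :
    ∃ Y ⊆ X, Y.Nonempty ∧ α ^ (p + 1) / 128 * #X ≤ #Y ∧
      65 / 64 < pairAvg Y Y (normDiff A α) := by
  have hex : ∃ q : ℕ, 1 ≤ q ∧ (33 / 32 : ℝ) ^ q ≤ pairAvg X X fun z => normDiff A α z ^ q :=
    ⟨p, hp, hm⟩
  obtain ⟨hq1, hq2⟩ := Nat.find_spec hex
  have hqp : Nat.find hex ≤ p := Nat.find_min' hex ⟨hp, hm⟩
  have hmin : ∀ r < Nat.find hex, _ := fun r hr => Nat.find_min hex hr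
  obtain ⟨q, hq⟩ : ∃ q, Nat.find hex = q + 1 := ⟨Nat.find hex - 1, by omega⟩
  rw [hq] at hq2 hqp hmin
  have hlow : (pairAvg X X fun z => normDiff A α z ^ q) ≤ (33 / 32 : ℝ) ^ q := by
    rcases Nat.eq_zero_or_pos q with h0 | h0
    · subst h0
      simp [pairAvg_const hX hX]
    · have := hmin q (by omega)
      push Not at this
      exact (this h0).le
  have hα' : α * (pairAvg X X fun z => normDiff A α z ^ (q + 1)) ≤
      pairAvg X X fun z => normDiff A α z ^ q := by
    rw [← pairAvg_mul]
    refine pairAvg_le _ _ fun z => ?_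
    have h1 := normDiff_le hA hα z
    have h2 := normDiff_nonneg (A := A) hα z
    rw [le_div_iff₀ hα] at h1
    rw [pow_succ]
    nlinarith [pow_nonneg h2 q]
  have h1 : (1 : ℝ) ≤ (33 / 32) ^ q := one_le_pow₀ (by norm_num)
  have h2 : α ≤ pairAvg X X fun z => normDiff A α z ^ q := by
    refine le_trans ?_ hα'
    rw [pow_succ] at hq2
    nlinarith
  obtain ⟨Y, hYX, hY, hc, hY'⟩ := exists_sift_of_ratio hA hα hX (k := q) (θ := 65 / 64)
    (η := α ^ (q + 2) / 128) (by norm_num) (by positivity) (by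
      have : α / 128 < (pairAvg X X fun z => normDiff A α z ^ (q + 1)) -
        65 / 64 * pairAvg X X fun z => normDiff A α z ^ q := by
        rw [pow_succ] at hq2
        nlinarith
      calc α ^ (q + 2) / 128 = α ^ (q + 1) * (α / 128) := by ring
        _ < _ := mul_lt_mul_of_pos_left this (by positivity))
  refine ⟨Y, hYX, hY, le_trans ?_ hc, hY'⟩
  have : α ^ (p + 1) ≤ α ^ (q + 2) := pow_le_pow_of_le_one hα.le hα1 (by omega)
  gcongr

lemma pow_siftExponent_le : ((1 : ℝ) - 1 / 1024) ^ 20480 ≤ (1 / 2) ^ 20 := by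
  have h : ((1 : ℝ) - 1 / 1024) ^ 1024 ≤ 1 / 2 := by
    have h1 := one_add_mul_le_pow (a := (1 / 1023 : ℝ)) (by norm_num) 1024
    have h2 : ((1 : ℝ) - 1 / 1024) = (1 + 1 / 1023)⁻¹ := by norm_num
    rw [h2, inv_pow, inv_le_comm₀ (by positivity) (by norm_num)]
    refine le_trans ?_ h1
    norm_num
  calc ((1 : ℝ) - 1 / 1024) ^ 20480 = (((1 : ℝ) - 1 / 1024) ^ 1024) ^ 20 := by rw [← pow_mul]
    _ ≤ (1 / 2) ^ 20 := by
      refine pow_le_pow_left₀ ?_ h 20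
      exact pow_nonneg (by norm_num) _

/-- The indicator of the points where `F` is smaller than `(1 - 2⁻¹⁰) τ`. -/
noncomputable def lowSet (F : G → ℝ) (τ : ℝ) (z : G) : ℝ :=
  if F z < (1 - 1 / 1024) * τ then 1 else 0

lemma lowSet_nonneg (F : G → ℝ) (τ : ℝ) (z : G) : 0 ≤ lowSet F τ z := by
  unfold lowSet
  split_ifs <;> simp

/-- Either the average can be doubled by sifting, or sifting yields a set concentrated on the
points where `normDiff` is about its average, without increasing the average by much. -/
lemma sift_dichotomy (hA : A.Nonempty) (hα : 0 < α) {X : Finset G}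
    (hX : X.Nonempty) {τ : ℝ} (hτ : pairAvg X X (normDiff A α) = τ) (hτ1 : 1 ≤ τ) :
    (∃ Y ⊆ X, Y.Nonempty ∧ α ^ 20481 * #X ≤ #Y ∧ 2 * τ < pairAvg Y Y (normDiff A α)) ∨
    ∃ Y ⊆ X, Y.Nonempty ∧ α ^ 20480 / 4 * #X ≤ #Y ∧ pairAvg Y Y (normDiff A α) ≤ 16 * τ ∧
      pairAvg Y Y (lowSet (normDiff A α) τ) ≤ 1 / 2 ^ 18 := by
  obtain ⟨k, hk⟩ : ∃ k : ℕ, k = 20480 := ⟨_, rfl⟩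
  have hpow := pow_siftExponent_le
  rw [← hk] at hpow
  rw [show 20481 = k + 1 by omega, show 20480 = k by omega]
  have hF0 := normDiff_nonneg (A := A) hα
  set F := normDiff A α with hF
  have hτk : τ ^ k ≤ pairAvg X X fun z => F z ^ k := hτ ▸ pow_pairAvg_le hX hF0 k
  have h1k : 1 ≤ τ ^ k := one_le_pow₀ hτ1
  rcases lt_or_ge (4 * τ * pairAvg X X fun z => F z ^ k) (pairAvg X X fun z => F z ^ (k + 1))
    with hgt | hle
  · left
    refine exists_sift_of_ratio hA hα hX (k := k) (by linarith) (by positivity) ?_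
    rw [← hF]
    have : 1 < (pairAvg X X fun z => F z ^ (k + 1)) - 2 * τ * pairAvg X X fun z => F z ^ k := by
      nlinarith
    exact lt_mul_of_one_lt_right (by positivity) this
  · right
    obtain ⟨Y, hYX, hY, hc, hp⟩ := exists_sift_normDiff hA hα hX (k := k) (H := 1)
      (η := α ^ k / 4)
      (h := fun z => 1 + ((-2 ^ 18) * lowSet F τ z + (-(1 / (16 * τ))) * F z)) (by positivity)
      (by positivity) (fun z => by
        have h1 := lowSet_nonneg F τ z
        have h2 : 0 ≤ 1 / (16 * τ) * F z := mul_nonneg (by positivity) (hF0 z)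
        linarith) (by
        rw [← hF]
        have e : (fun z => F z ^ k * (1 + ((-2 ^ 18) * lowSet F τ z + (-(1 / (16 * τ))) * F z))) =
          fun z => F z ^ k + ((-2 ^ 18) * (F z ^ k * lowSet F τ z) +
            (-(1 / (16 * τ))) * F z ^ (k + 1)) := by
          funext z; ring
        have hlow : pairAvg X X (fun z => F z ^ k * lowSet F τ z) ≤ (1 / 2) ^ 20 * τ ^ k := by
          calc pairAvg X X (fun z => F z ^ k * lowSet F τ z)
              ≤ pairAvg X X (fun _ => (1 - 1 / 1024) ^ k * τ ^ k) := by
                refine pairAvg_le _ _ fun z => ?_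
                unfold lowSet
                split_ifs with hz
                · rw [mul_one, ← mul_pow]
                  exact pow_le_pow_left₀ (hF0 z) hz.le k
                · rw [mul_zero]
                  exact mul_nonneg (pow_nonneg (by norm_num) _) (by positivity)
            _ = (1 - 1 / 1024) ^ k * τ ^ k := pairAvg_const hX hX _
            _ ≤ _ := by gcongr
        have hup : 1 / (16 * τ) * (pairAvg X X fun z => F z ^ (k + 1)) ≤
            1 / 4 * pairAvg X X fun z => F z ^ k := by
          rw [one_div_mul_eq_div, div_le_iff₀ (by positivity)]
          linarith
        rw [e, pairAvg_add, pairAvg_add, pairAvg_mul, pairAvg_mul, one_mul, div_eq_mul_one_div]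
        refine mul_lt_mul_of_pos_left ?_ (by positivity)
        norm_num at hlow ⊢
        norm_num at hup
        linarith)
    have h1 : 0 ≤ pairAvg Y Y (lowSet F τ) := by
      have := pairAvg_le Y Y (lowSet_nonneg F τ)
      rwa [pairAvg_const hY hY] at this
    have h2 : 0 ≤ pairAvg Y Y F := by
      have := pairAvg_le Y Y hF0
      rwa [pairAvg_const hY hY] at this
    rw [pairAvg_add, pairAvg_add, pairAvg_mul, pairAvg_mul, pairAvg_const hY hY] at hp
    have h3 : 0 ≤ 1 / (16 * τ) * pairAvg Y Y F := by positivity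
    refine ⟨Y, hYX, hY, hc, ?_, ?_⟩
    · have : 1 / (16 * τ) * pairAvg Y Y F ≤ 1 := by linarith
      rwa [one_div_mul_eq_div, div_le_one (by positivity)] at this
    · norm_num at hp h3 ⊢
      linarith

end Steps

lemma sum_filter_sub_mem (Y Q : Finset G) (g : G → ℝ) :
    ∑ t, ∑ y ∈ Y.filter (fun y => y - t ∈ Q), g y = #Q * ∑ y ∈ Y, g y := by
  simp_rw [Finset.sum_filter]
  rw [Finset.sum_comm, Finset.mul_sum]
  refine Finset.sum_congr rfl fun y _ => ?_
  rw [Fintype.sum_equiv (Equiv.subLeft y) _ (fun u => if u ∈ Q then g y else 0) (fun t => by simp)]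
  simp

/-- Localising one side of a pair to a translate of a small set `Q`. -/
lemma exists_localise {Y P Q W : Finset G} (hY : Y.Nonempty) (hQ : Q.Nonempty)
    (hYP : Y ⊆ P) (hW : ∀ x ∈ P, ∀ y ∈ Q, x - y ∈ W) (hWP : (#W : ℝ) ≤ 2 * #P)
    {e : G → ℝ} (he : ∀ z, 0 ≤ e z) (hYe : pairAvg Y Y e ≤ 1 / 2 ^ 18) :
    ∃ t, ∃ Z ⊆ Y, Z.Nonempty ∧ (∀ z ∈ Z, z - t ∈ Q) ∧
      1 / 4 * (#Y / #P : ℝ) ≤ #Z / #Q ∧ pairAvg Y Z e ≤ 1 / 2 ^ 12 := by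
  by_contra! hcon
  have hY0 : (0 : ℝ) < #Y := by exact_mod_cast hY.card_pos
  have hQ0 : (0 : ℝ) < #Q := by exact_mod_cast hQ.card_pos
  have hP0 : (0 : ℝ) < #P := by exact_mod_cast (hY.mono hYP).card_pos
  set Z : G → Finset G := fun t => Y.filter (fun y => y - t ∈ Q) with hZ
  have hpt : ∀ t, (#(Z t) : ℝ) ≤ 1 / 4 * (#Y / #P) * #Q * (if t ∈ W then 1 else 0) +
      2 ^ 12 / #Y * pairSum Y (Z t) e := by
    intro t
    have hps : 0 ≤ pairSum Y (Z t) e :=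
      Finset.sum_nonneg fun _ _ => Finset.sum_nonneg fun _ _ => he _
    rcases (Z t).eq_empty_or_nonempty with h0 | hne
    · rw [h0, Finset.card_empty, Nat.cast_zero]
      rw [h0] at hps
      split_ifs <;> positivity
    · have hZ0 : (0 : ℝ) < #(Z t) := by exact_mod_cast hne.card_pos
      rcases le_or_gt (1 / 4 * (#Y / #P : ℝ)) (#(Z t) / #Q) with hb | hb
      · have h1 := hcon t (Z t) (Finset.filter_subset _ _) hne
          (fun z hz => (Finset.mem_filter.1 hz).2) hb
        rw [pairAvg, div_lt_div_iff₀ (by positivity) (by positivity)] at h1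
        have h2 : (#(Z t) : ℝ) ≤ 2 ^ 12 / #Y * pairSum Y (Z t) e := by
          rw [div_mul_eq_mul_div, le_div_iff₀ hY0]
          linarith
        refine h2.trans (le_add_of_nonneg_left ?_)
        split_ifs <;> positivity
      · obtain ⟨z, hz⟩ := hne
        have hz' := Finset.mem_filter.1 hz
        have htW : t ∈ W := by
          have := hW z (hYP hz'.1) _ hz'.2
          simpa using this
        rw [div_lt_iff₀ hQ0] at hb
        rw [if_pos htW, mul_one]
        refine hb.le.trans (le_add_of_nonneg_right ?_)
        positivity
  have hsum := Finset.sum_le_sum fun t (_ : t ∈ (Finset.univ : Finset G)) => hpt t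
  have e1 : ∑ t, (#(Z t) : ℝ) = #Q * #Y := by
    have := sum_filter_sub_mem Y Q fun _ => 1
    simpa using this
  have e2 : ∑ t, pairSum Y (Z t) e = #Q * pairSum Y Y e := by
    unfold pairSum
    rw [Finset.sum_comm, Finset.mul_sum]
    exact Finset.sum_congr rfl fun x _ => sum_filter_sub_mem Y Q fun y => e (y - x)
  rw [Finset.sum_add_distrib, ← Finset.mul_sum, ← Finset.mul_sum, e1, e2] at hsum
  simp only [Finset.sum_ite_mem, Finset.univ_inter, Finset.sum_const, nsmul_eq_mul,
    mul_one] at hsum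
  rw [pairAvg, div_le_iff₀ (by positivity)] at hYe
  have h1 : 1 / 4 * (#Y / #P : ℝ) * #Q * #W ≤ 1 / 2 * (#Q * #Y) := by
    calc 1 / 4 * (#Y / #P : ℝ) * #Q * #W ≤ 1 / 4 * (#Y / #P : ℝ) * #Q * (2 * #P) := by gcongr
      _ = _ := by field_simp; norm_num
  have h2 : 2 ^ 12 / #Y * (#Q * pairSum Y Y e) ≤ 1 / 64 * (#Q * #Y : ℝ) := by
    calc 2 ^ 12 / #Y * (#Q * pairSum Y Y e)
        ≤ 2 ^ 12 / #Y * (#Q * (1 / 2 ^ 18 * (#Y * #Y))) := by gcongr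
      _ = _ := by field_simp; norm_num
  nlinarith [mul_pos hQ0 hY0]

/-! ### Regular dilates of Bohr sets -/

/-- A monotone function with small total increase has a point around which all its increments are
small. -/
lemma exists_increment_le {f : ℝ → ℝ} (hf : Monotone f) {a b r l : ℝ} (hl : 0 < l) (hab : a ≤ b)
    (hlt : 8 * (f (b + r) - f (a - r)) < l * (b - a)) :
    ∃ x ∈ Set.Icc a b, ∀ h, 0 < h → h ≤ r → f (x + h) - f (x - h) ≤ l * h := by
  by_contra! hcon
  choose! w hw0 hwr hw using hcon
  obtain ⟨t, ht, htc⟩ := isCompact_Icc.elim_nhds_subcover (fun x => Metric.ball x (w x))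
    fun x hx => Metric.ball_mem_nhds x (hw0 x hx)
  obtain ⟨u, hut, hud, huc⟩ := Vitali.exists_disjoint_subfamily_covering_enlargement_ball
    (t : Set ℝ) id w r (fun x hx => hwr x (ht x hx)) 4 (by norm_num)
  have hufin : u.Finite := t.finite_toSet.subset hut
  obtain ⟨v, rfl⟩ := hufin.exists_finset_coe
  have hv : ∀ x ∈ v, x ∈ Set.Icc a b := fun x hx => ht x (hut hx)
  have hcov : Set.Icc a b ⊆ ⋃ x ∈ v, Metric.ball x (4 * w x) := by
    intro y hy
    obtain ⟨x, hx, hyx⟩ := Set.mem_iUnion₂.1 (htc hy)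
    obtain ⟨z, hz, hxz⟩ := huc x hx
    exact Set.mem_iUnion₂.2 ⟨z, hz, hxz hyx⟩
  have hlen : b - a ≤ ∑ x ∈ v, 8 * w x := by
    have h1 := (MeasureTheory.measure_mono (μ := MeasureTheory.volume) hcov).trans
      (MeasureTheory.measure_biUnion_finset_le v _)
    simp only [Real.volume_Icc, Real.volume_ball] at h1
    rw [← ENNReal.ofReal_sum_of_nonneg fun x hx => by have := hw0 x (hv x hx); positivity] at h1
    rw [ENNReal.ofReal_le_ofReal_iff
      (Finset.sum_nonneg fun x hx => by have := hw0 x (hv x hx); positivity)] at h1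
    refine h1.trans_eq (Finset.sum_congr rfl fun x _ => by ring)
  have hmem : ∀ x ∈ v, f (x - w x) ≤ f (x + w x) := fun x hx =>
    hf (by linarith [hw0 x (hv x hx)])
  have hincr : ∑ x ∈ v, (f (x + w x) - f (x - w x)) ≤ f (b + r) - f (a - r) := by
    have hsub : (⋃ x ∈ v, Set.Ioo (f (x - w x)) (f (x + w x))) ⊆
        Set.Icc (f (a - r)) (f (b + r)) := by
      refine Set.iUnion₂_subset fun x hx y hy => ?_
      have h1 := hv x hx
      have h2 := hwr x h1
      exact ⟨(hf (by linarith [h1.1])).trans hy.1.le, hy.2.le.trans (hf (by linarith [h1.2]))⟩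
    have hdisj : Set.PairwiseDisjoint (v : Set ℝ)
        fun x => Set.Ioo (f (x - w x)) (f (x + w x)) := by
      intro x hx y hy hxy
      have h1 := hud hx hy hxy
      have hx0 := hw0 x (hv x hx)
      have hy0 := hw0 y (hv y hy)
      simp only [Function.onFun, id, Real.ball_eq_Ioo, Set.Ioo_disjoint_Ioo] at h1 ⊢
      rcases le_total x y with h | h
      · have : x + w x ≤ y - w y := by
          by_contra! hc
          rcases le_total (x + w x) (y + w y) with h3 | h3 <;>
          rcases le_total (x - w x) (y - w y) with h4 | h4 <;>
          simp only [min_eq_left h3, min_eq_right h3, max_eq_left h4, max_eq_right h4] at h1 <;>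
          linarith
        exact (min_le_left _ _).trans ((hf this).trans (le_max_right _ _))
      · have : y + w y ≤ x - w x := by
          by_contra! hc
          rcases le_total (x + w x) (y + w y) with h3 | h3 <;>
          rcases le_total (x - w x) (y - w y) with h4 | h4 <;>
          simp only [min_eq_left h3, min_eq_right h3, max_eq_left h4, max_eq_right h4] at h1 <;>
          linarith
        exact (min_le_right _ _).trans ((hf this).trans (le_max_left _ _))
    have h1 := MeasureTheory.measure_mono (μ := MeasureTheory.volume) hsub
    rw [MeasureTheory.measure_biUnion_finset hdisj fun _ _ => measurableSet_Ioo] at h1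
    simp only [Real.volume_Icc, Real.volume_Ioo] at h1
    rw [← ENNReal.ofReal_sum_of_nonneg fun x hx => sub_nonneg.2 (hmem x hx)] at h1
    have hr : f (a - r) ≤ f (b + r) := by
      rcases v.eq_empty_or_nonempty with rfl | ⟨x, hx⟩
      · have : b - a ≤ 0 := by simpa using hlen
        have h2 : b - a = 0 := by linarith
        rw [h2, mul_zero] at hlt
        obtain ⟨z, hz, -⟩ := Set.mem_iUnion₂.1 (hcov ⟨le_rfl, hab⟩)
        simp at hz
      · have h2 := hv x hx
        have h3 := hwr x h2
        have h4 := hw0 x h2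
        exact hf (by linarith)
    rwa [ENNReal.ofReal_le_ofReal_iff (sub_nonneg.2 hr)] at h1
  have hfin : l * ∑ x ∈ v, 8 * w x ≤ 8 * ∑ x ∈ v, (f (x + w x) - f (x - w x)) := by
    rw [Finset.mul_sum, Finset.mul_sum]
    refine Finset.sum_le_sum fun x hx => ?_
    have := hw x (hv x hx)
    linarith
  have := mul_le_mul_of_nonneg_left hlen hl.le
  linarith

namespace Bohr

lemma card_carrier (B : Bohr G) : Nat.card B.carrier = #(univ.filter (· ∈ B.carrier)) := by
  rw [Nat.card_eq_fintype_card, Fintype.card_subtype]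

lemma card_mono {B B' : Bohr G} (h : B.carrier ⊆ B'.carrier) :
    Nat.card B.carrier ≤ Nat.card B'.carrier :=
  Nat.card_mono (Set.toFinite _) h

lemma zero_mem_carrier {B : Bohr G} (h : 0 ≤ B.radius) : (0 : G) ∈ B.carrier := by
  intro γ _
  simpa using h

lemma carrier_subset {Λ : Finset (AddChar G ℂ)} {r s : ℝ} (h : r ≤ s) :
    (⟨Λ, r⟩ : Bohr G).carrier ⊆ (⟨Λ, s⟩ : Bohr G).carrier :=
  fun _ hx γ hγ => (hx γ hγ).trans h

lemma norm_one_sub_sub (γ : AddChar G ℂ) (x y : G) : ‖1 - γ (x - y)‖ = ‖γ y - γ x‖ := by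
  have h : γ (x - y) * γ y = γ x := by rw [← AddChar.map_add_eq_mul, sub_add_cancel]
  calc ‖1 - γ (x - y)‖ = ‖1 - γ (x - y)‖ * ‖γ y‖ := by rw [AddChar.norm_apply, mul_one]
    _ = ‖γ y - γ x‖ := by rw [← norm_mul, sub_mul, one_mul, h]

lemma sub_mem_carrier {Λ : Finset (AddChar G ℂ)} {r s : ℝ} {x y : G}
    (hx : x ∈ (⟨Λ, r⟩ : Bohr G).carrier) (hy : y ∈ (⟨Λ, s⟩ : Bohr G).carrier) :
    x - y ∈ (⟨Λ, r + s⟩ : Bohr G).carrier := by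
  intro γ hγ
  rw [norm_one_sub_sub]
  calc ‖γ y - γ x‖ = ‖(1 - γ x) - (1 - γ y)‖ := by congr 1; ring
    _ ≤ ‖1 - γ x‖ + ‖1 - γ y‖ := norm_sub_le _ _
    _ ≤ r + s := add_le_add (hx γ hγ) (hy γ hγ)

lemma abs_sub_le_of_floor_eq {x y w : ℝ} (hw : 0 < w) (hx : 0 ≤ x) (hy : 0 ≤ y)
    (h : ⌊x / w⌋₊ = ⌊y / w⌋₊) : |x - y| ≤ w := by
  have h1 := Nat.floor_le (div_nonneg hx hw.le)
  have h2 := Nat.lt_floor_add_one (x / w)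
  have h3 := Nat.floor_le (div_nonneg hy hw.le)
  have h4 := Nat.lt_floor_add_one (y / w)
  rw [h] at h1 h2
  rw [le_div_iff₀ hw] at h1 h3
  rw [div_lt_iff₀ hw] at h2 h4
  rw [abs_le]
  constructor <;> linarith

lemma floor_lt_eight {x R : ℝ} (hR : 0 < R) (hx : x ≤ 4 * R) : ⌊x / (2 / 3 * R)⌋₊ < 8 := by
  rw [Nat.floor_lt' (by norm_num), div_lt_iff₀ (by positivity)]
  push_cast
  linarith

lemma card_double_le (Λ : Finset (AddChar G ℂ)) {R : ℝ} (hR : 0 < R) :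
    Nat.card (⟨Λ, 2 * R⟩ : Bohr G).carrier ≤
      Nat.card (⟨Λ, R⟩ : Bohr G).carrier * 64 ^ #Λ := by
  rw [card_carrier, card_carrier]
  set w : ℝ := 2 / 3 * R with hw
  have hw0 : 0 < w := by positivity
  have hcard : #(Fintype.piFinset fun _ : Λ => Finset.range 8 ×ˢ Finset.range 8) = 64 ^ #Λ := by
    simp
  have hbd : ∀ x ∈ (⟨Λ, 2 * R⟩ : Bohr G).carrier, ∀ γ ∈ Λ,
      (0 ≤ (γ x - 1).re + 2 * R ∧ (γ x - 1).re + 2 * R ≤ 4 * R) ∧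
      (0 ≤ (γ x - 1).im + 2 * R ∧ (γ x - 1).im + 2 * R ≤ 4 * R) := by
    intro x hx γ hγ
    have h := hx γ hγ
    rw [norm_sub_rev] at h
    have h1 := abs_le.1 ((Complex.abs_re_le_norm _).trans h)
    have h2 := abs_le.1 ((Complex.abs_im_le_norm _).trans h)
    dsimp only at h1 h2
    refine ⟨⟨?_, ?_⟩, ?_, ?_⟩ <;> linarith
  rw [← hcard]
  refine Finset.card_le_mul_card_image_of_maps_to (f := fun x (γ : Λ) =>
    (⌊((γ.1 x - 1).re + 2 * R) / w⌋₊, ⌊((γ.1 x - 1).im + 2 * R) / w⌋₊)) ?_ _ ?_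
  · intro x hx
    have hx' := (Finset.mem_filter.1 hx).2
    rw [Fintype.mem_piFinset]
    intro γ
    have h := hbd x hx' γ.1 γ.2
    exact Finset.mem_product.2 ⟨Finset.mem_range.2 (floor_lt_eight hR h.1.2),
      Finset.mem_range.2 (floor_lt_eight hR h.2.2)⟩
  · intro b _
    rcases Finset.eq_empty_or_nonempty (Finset.filter (fun x => (fun (γ : Λ) =>
      (⌊((γ.1 x - 1).re + 2 * R) / w⌋₊, ⌊((γ.1 x - 1).im + 2 * R) / w⌋₊)) = b)
      (univ.filter (· ∈ (⟨Λ, 2 * R⟩ : Bohr G).carrier))) with h0 | ⟨x₀, hx₀⟩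
    · rw [h0]; simp
    · refine Finset.card_le_card_of_injOn (fun x => x - x₀) ?_ (sub_left_injective.injOn)
      intro x hx
      simp only [Finset.coe_filter, Finset.mem_filter, Finset.mem_univ, true_and,
        Set.mem_ofPred_eq] at hx hx₀ ⊢
      intro γ hγ
      rw [norm_one_sub_sub]
      have hb := congrFun (hx.2.trans hx₀.2.symm) ⟨γ, hγ⟩
      simp only [Prod.mk.injEq] at hb
      have h1 := hbd x hx.1 γ hγ
      have h2 := hbd x₀ hx₀.1 γ hγ
      have h3 := abs_sub_le_of_floor_eq hw0 h1.1.1 h2.1.1 hb.1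
      have h4 := abs_sub_le_of_floor_eq hw0 h1.2.1 h2.2.1 hb.2
      have h5 : ‖γ x₀ - γ x‖ ^ 2 ≤ R ^ 2 := by
        rw [← Complex.normSq_eq_norm_sq, Complex.normSq_apply]
        simp only [Complex.sub_re, Complex.sub_im, Complex.one_re, Complex.one_im] at h3 h4 ⊢
        have h6 := sq_le_sq' (abs_le.1 h3).1 (abs_le.1 h3).2
        have h7 := sq_le_sq' (abs_le.1 h4).1 (abs_le.1 h4).2
        rw [hw] at h6 h7
        nlinarith [sq_nonneg R]
      exact abs_le_of_sq_le_sq' h5 hR.le |>.2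

lemma regular_of_carrier_eq {B : Bohr G}
    (h : ∀ κ : ℝ, |κ| ≤ 1 / (100 * B.rank) → (B.dilate (1 + κ)).carrier = B.carrier) :
    B.Regular := by
  intro κ hκ
  rw [h κ hκ]
  have h1 : 0 ≤ 100 * B.rank * |κ| * (Nat.card B.carrier : ℝ) := by positivity
  constructor <;> linarith

lemma abs_le_of_rank {d : ℕ} {κ : ℝ} (h : |κ| ≤ 1 / (100 * d)) : |κ| ≤ 1 / 100 := by
  refine h.trans ?_
  rcases Nat.eq_zero_or_pos d with rfl | hd
  · norm_num
  · have : (1 : ℝ) ≤ d := by exact_mod_cast hd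
    exact one_div_le_one_div_of_le (by norm_num) (by linarith)

lemma exists_regular_radius {Λ : Finset (AddChar G ℂ)} (hΛ : Λ.Nonempty) {R : ℝ} (hR : 0 < R) :
    ∃ s, R ≤ s ∧ s ≤ 2 * R ∧ (⟨Λ, s⟩ : Bohr G).Regular := by
  set n : ℝ → ℝ := fun x => (Nat.card (⟨Λ, x⟩ : Bohr G).carrier : ℝ) with hn
  have hnmono : Monotone n := fun x y hxy => Nat.cast_le.2 (card_mono (carrier_subset hxy))
  have hnpos : ∀ x, 0 < x → 0 < n x := fun x hx => by
    have : Nonempty (⟨Λ, x⟩ : Bohr G).carrier := ⟨⟨0, zero_mem_carrier hx.le⟩⟩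
    exact Nat.cast_pos.2 Nat.card_pos
  set d : ℝ := (#Λ : ℝ) with hd
  have hd1 : 1 ≤ d := Nat.one_le_cast.2 hΛ.card_pos
  set f : ℝ → ℝ := fun a => Real.log (n (R * Real.exp a)) with hf
  have hfmono : Monotone f := fun a b hab => by
    refine Real.log_le_log (hnpos _ (by positivity)) (hnmono ?_)
    gcongr
  have hl2 := Real.log_two_gt_d9
  have hl2' := Real.log_two_lt_d9
  have htotal : f (Real.log 2) - f 0 ≤ d * (6 * Real.log 2) := by
    have h1 : n (2 * R) ≤ n R * 64 ^ #Λ := by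
      have := card_double_le Λ hR
      simp only [hn]
      exact_mod_cast this
    have h2 : f (Real.log 2) ≤ Real.log (n R * 64 ^ #Λ) := by
      rw [hf]
      dsimp only
      rw [Real.exp_log (by norm_num), mul_comm R 2]
      exact Real.log_le_log (hnpos _ (by positivity)) h1
    rw [Real.log_mul (hnpos R hR).ne' (by positivity), Real.log_pow,
      show (64 : ℝ) = 2 ^ 6 by norm_num, Real.log_pow] at h2
    have h3 : f 0 = Real.log (n R) := by simp [hf]
    rw [h3]
    push_cast at h2
    linarith
  obtain ⟨a, ha, hinc⟩ := exists_increment_le hfmono (a := 1 / 99) (b := Real.log 2 - 1 / 99)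
    (r := 1 / 99) (l := 66 * d) (by positivity) (by linarith) (by
      rw [sub_add_cancel, sub_self]
      nlinarith)
  set s : ℝ := R * Real.exp a with hs
  have hs0 : 0 < s := by positivity
  refine ⟨s, ?_, ?_, ?_⟩
  · have : 1 ≤ Real.exp a := Real.one_le_exp (by linarith [ha.1])
    nlinarith
  · have : Real.exp a ≤ 2 := by
      rw [← Real.le_log_iff_exp_le (by norm_num)]
      linarith [ha.2]
    nlinarith
  · intro κ hκ
    have hrank : ((⟨Λ, s⟩ : Bohr G).rank : ℝ) = d := rfl
    rw [hrank] at hκ ⊢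
    change (1 - 100 * d * |κ|) * n s ≤ n ((1 + κ) * s) ∧
      n ((1 + κ) * s) ≤ (1 + 100 * d * |κ|) * n s
    have hκ1 : |κ| ≤ 1 / 100 := abs_le_of_rank hκ
    have hκd : 100 * d * |κ| ≤ 1 := by
      rw [le_div_iff₀ (by positivity)] at hκ
      linarith
    have hns := hnpos s hs0
    have hf0 : f a = Real.log (n s) := rfl
    have hfh : ∀ u : ℝ, 0 < u → f (a + Real.log u) = Real.log (n (u * s)) := by
      intro u hu
      simp only [hf, hs]
      rw [Real.exp_add, Real.exp_log hu]
      congr 2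
      ring
    have hpos : 0 ≤ 100 * d * |κ| := by positivity
    have ht : 0 ≤ 100 * d * |κ| * n s := by positivity
    rcases lt_trichotomy κ 0 with h | h | h
    · rw [abs_of_neg h] at *
      have hu : 0 < 1 + κ := by linarith
      refine ⟨?_, ?_⟩
      · have hlog : Real.log (1 + κ) < 0 := Real.log_neg hu (by linarith)
        have hlog2 : -Real.log (1 + κ) ≤ -κ * (100 / 99) := by
          have h1 := Real.one_sub_inv_le_log_of_pos hu
          have h2 : (1 + κ)⁻¹ ≤ 1 - κ * (100 / 99) := by
            rw [inv_le_iff_one_le_mul₀ hu]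
            nlinarith
          linarith
        have h1 := hinc (-Real.log (1 + κ)) (by linarith) (by linarith)
        rw [sub_neg_eq_add, hfh _ hu] at h1
        have h2 : f a ≤ f (a + -Real.log (1 + κ)) := hfmono (by linarith)
        have h3 : Real.log (n s) - Real.log (n ((1 + κ) * s)) ≤ 100 * d * -κ := by
          rw [← hf0]
          have h4 : 66 * d * -Real.log (1 + κ) ≤ 66 * d * (-κ * (100 / 99)) := by gcongr
          nlinarith
        have hnu := hnpos _ (mul_pos hu hs0)
        have h5 : n s * Real.exp (-(100 * d * -κ)) ≤ n ((1 + κ) * s) := by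
          rw [← Real.log_le_log_iff (by positivity) hnu, Real.log_mul hns.ne' (by positivity),
            Real.log_exp]
          linarith
        have h6 := Real.add_one_le_exp (-(100 * d * -κ))
        nlinarith
      · have : n ((1 + κ) * s) ≤ n s := hnmono (by nlinarith)
        linarith
    · subst h
      simp
    · rw [abs_of_pos h] at *
      have hu : 0 < 1 + κ := by linarith
      refine ⟨?_, ?_⟩
      · have : n s ≤ n ((1 + κ) * s) := hnmono (by nlinarith)
        linarith
      · have hlog : 0 < Real.log (1 + κ) := Real.log_pos (by linarith)
        have hlog2 : Real.log (1 + κ) ≤ κ := by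
          have := Real.log_le_sub_one_of_pos hu
          linarith
        have h1 := hinc (Real.log (1 + κ)) hlog (by linarith)
        rw [hfh _ hu] at h1
        have h2 : f (a - Real.log (1 + κ)) ≤ f a := hfmono (by linarith)
        have h3 : 66 * d * κ ≤ Real.log (1 + 100 * d * κ) := by
          refine le_trans ?_ (Real.le_log_one_add_of_nonneg hpos)
          rw [le_div_iff₀ (by linarith)]
          nlinarith [mul_pos (by linarith : 0 < d) h]
        have h4 : 66 * d * Real.log (1 + κ) ≤ 66 * d * κ := by gcongr
        have hnu := hnpos _ (mul_pos hu hs0)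
        rw [← Real.log_le_log_iff hnu (by positivity), Real.log_mul (by positivity) hns.ne']
        linarith

lemma exists_subR (B : Bohr G) {r : ℝ} (hr : 0 < r) :
    ∃ B', subR (r / B.rank) B' B := by
  rcases B.freq.eq_empty_or_nonempty with h0 | hne
  · have hr0 : (B.rank : ℝ) = 0 := by simp [rank, h0]
    refine ⟨B.dilate 0, 0, by simp [hr0], by simp [hr0], rfl, regular_of_carrier_eq fun κ _ => ?_⟩
    simp [carrier, dilate, h0]
  have hd : (0 : ℝ) < B.rank := by exact_mod_cast hne.card_pos
  set q := r / B.rank with hq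
  have hq0 : 0 < q := by positivity
  rcases le_or_gt B.radius 0 with hrad | hrad
  · refine ⟨B.dilate q, q, by linarith, le_rfl, rfl, regular_of_carrier_eq fun κ hκ => ?_⟩
    have hκ1 := abs_le.1 (abs_le_of_rank hκ)
    rcases hrad.lt_or_eq with hlt | heq
    · have hempty : ∀ C : Bohr G, C.freq = B.freq → C.radius < 0 → C.carrier = ∅ := by
        intro C hC hC0
        obtain ⟨γ, hγ⟩ := hne
        refine Set.eq_empty_of_forall_notMem fun x hx => ?_
        exact absurd ((norm_nonneg _).trans (hx γ (hC ▸ hγ))) (not_le.2 hC0)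
      rw [hempty (B.dilate q) rfl (mul_neg_of_pos_of_neg hq0 hlt)]
      exact hempty _ rfl
        (mul_neg_of_pos_of_neg (by linarith [hκ1.1]) (mul_neg_of_pos_of_neg hq0 hlt))
    · simp [carrier, dilate, heq]
  · obtain ⟨s, hs1, hs2, hs⟩ := exists_regular_radius hne (R := q / 2 * B.radius) (by positivity)
    refine ⟨B.dilate (s / B.radius), s / B.radius, ?_, ?_, rfl, ?_⟩
    · rwa [le_div_iff₀ hrad]
    · rw [div_le_iff₀ hrad]
      linarith
    · have : B.dilate (s / B.radius) = ⟨B.freq, s⟩ := by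
        simp [dilate, hrad.ne']
      rwa [this]

lemma nonneg_radius_or_freq_empty {B : Bohr G} (h : B.carrier.Nonempty) :
    0 ≤ B.radius ∨ B.freq = ∅ := by
  rcases B.freq.eq_empty_or_nonempty with h0 | ⟨γ, hγ⟩
  · exact Or.inr h0
  · obtain ⟨x, hx⟩ := h
    exact Or.inl ((norm_nonneg _).trans (hx γ hγ))

end Bohr

/-! ### Averages over difference convolutions -/

lemma pairSum_map (X Y : Finset G) (t : G) (h : G → ℝ) :
    pairSum (X.map (addRightEmbedding t)) (Y.map (addRightEmbedding t)) h = pairSum X Y h := by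
  simp [pairSum]

lemma pairAvg_map (X Y : Finset G) (t : G) (h : G → ℝ) :
    pairAvg (X.map (addRightEmbedding t)) (Y.map (addRightEmbedding t)) h = pairAvg X Y h := by
  simp [pairAvg, pairSum_map]

lemma natCard_coe (X : Finset G) : Nat.card ((X : Set G) : Type _) = #X := by
  simp

lemma ip_comm (f g : G → ℝ) : ip f g = ip g f := by
  simp only [ip, mul_comm]

lemma ip_dcv_mu (X Y : Finset G) (g : G → ℝ) :
    ip g (dcv (mu (X : Set G)) (mu (Y : Set G))) = pairAvg X Y g := by
  have hN : (Fintype.card G : ℝ) ≠ 0 := by exact_mod_cast Fintype.card_ne_zero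
  have key : pairSum X Y g =
      ∑ z, ∑ x, g z * ((if x ∈ X then (1 : ℝ) else 0) * (if z + x ∈ Y then 1 else 0)) := by
    rw [Finset.sum_comm, pairSum, ← Finset.sum_ite_mem_eq X]
    refine Finset.sum_congr rfl fun x _ => ?_
    split_ifs with hx
    · rw [← Finset.sum_ite_mem_eq Y]
      refine (Fintype.sum_equiv (Equiv.addRight x) _ _ fun z => ?_).symm
      simp
    · simp
  have hmu : ∀ (Z : Finset G) (x : G), mu (Z : Set G) x =
      (Fintype.card G / #Z : ℝ) * (if x ∈ Z then (1 : ℝ) else 0) := by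
    intro Z x
    simp only [mu, natCard_coe, Finset.mem_coe]
    split_ifs <;> simp
  rw [pairAvg, key]
  simp only [ip, ex, dcv, hmu]
  rw [Finset.sum_div, Finset.sum_div]
  refine Finset.sum_congr rfl fun z _ => ?_
  rw [Finset.sum_div, Finset.mul_sum, Finset.sum_div, Finset.sum_div]
  refine Finset.sum_congr rfl fun x _ => ?_
  field_simp

lemma dcv_mu_self (A : Finset G) (z : G) :
    dcv (mu (A : Set G)) (mu (A : Set G)) z =
      Fintype.card G / ((#A : ℝ) * #A) * diffCount A z := by
  have hN : (Fintype.card G : ℝ) ≠ 0 := by exact_mod_cast Fintype.card_ne_zero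
  simp only [dcv, ex, mu, natCard_coe, Finset.mem_coe, diffCount]
  rw [Finset.sum_div, Finset.mul_sum]
  refine Finset.sum_congr rfl fun x _ => ?_
  split_ifs <;> simp
  field_simp

lemma pairSum_one (X Y : Finset G) (k : ℕ) (A : Finset G) :
    ∑ s : Fin k → G, (#(sift A X s) : ℝ) * #(sift A Y s) =
      pairSum X Y fun z => diffCount A z ^ k := by
  have := sum_pairSum_sift A X Y k fun _ => 1
  simpa [pairSum_const] using this

/-- The moments of `diffCount` over a set of differences do not increase under translation. -/
lemma pairSum_shift_le (A P : Finset G) (k : ℕ) (w : G) :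
    (pairSum P P fun z => diffCount A (z + w) ^ k) ≤ pairSum P P fun z => diffCount A z ^ k := by
  have h1 := pairSum_one P (P.map (addRightEmbedding w)) k A
  have h2 := pairSum_one (P.map (addRightEmbedding w)) (P.map (addRightEmbedding w)) k A
  have h3 := pairSum_one P P k A
  rw [pairSum_map] at h2
  have h4 : (pairSum P (P.map (addRightEmbedding w)) fun z => diffCount A z ^ k) =
      pairSum P P fun z => diffCount A (z + w) ^ k := by
    simp [pairSum, sub_add_eq_add_sub]
  rw [← h4, ← h1]
  have h5 : ∑ s : Fin k → G, (#(sift A P s) : ℝ) * #(sift A (P.map (addRightEmbedding w)) s) ≤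
      ∑ s : Fin k → G, (1 / 2) * ((#(sift A P s) : ℝ) * #(sift A P s) +
        (#(sift A (P.map (addRightEmbedding w)) s) : ℝ) *
          #(sift A (P.map (addRightEmbedding w)) s)) := by
    refine Finset.sum_le_sum fun s _ => ?_
    nlinarith [sq_nonneg ((#(sift A P s) : ℝ) - #(sift A (P.map (addRightEmbedding w)) s))]
  rw [← Finset.mul_sum, Finset.sum_add_distrib, h2, h3] at h5
  linarith

lemma ex_pow_mul_cv_le {A P Q : Finset G} {α : ℝ} (hα : 0 < α) (k : ℕ) :
    ex (fun z => normDiff A α z ^ k *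
      cv (dcv (mu (P : Set G)) (mu (P : Set G))) (dcv (mu (Q : Set G)) (mu (Q : Set G))) z) ≤
      pairAvg P P fun z => normDiff A α z ^ k := by
  set β₁ := dcv (mu (P : Set G)) (mu (P : Set G)) with hβ₁
  set β₂ := dcv (mu (Q : Set G)) (mu (Q : Set G)) with hβ₂
  set F := fun z => normDiff A α z ^ k with hF
  have hβ₂0 : ∀ w, 0 ≤ β₂ w := fun w => by
    rw [hβ₂, dcv_mu_self]
    exact mul_nonneg (by positivity) (diffCount_nonneg Q w)
  have hF0 : 0 ≤ pairAvg P P F := by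
    refine div_nonneg (Finset.sum_nonneg fun _ _ => Finset.sum_nonneg fun _ _ => ?_) (by positivity)
    exact pow_nonneg (normDiff_nonneg hα _) _
  have hshift : ∀ w, ip (fun y => F (y + w)) β₁ ≤ pairAvg P P F := fun w => by
    rw [hβ₁, ip_dcv_mu]
    have e : F = fun z => (1 / (α * #A)) ^ k * diffCount A z ^ k := by
      funext z
      rw [hF, ← mul_pow]
      dsimp only [normDiff]
      congr 1
      ring
    rw [e]
    rw [pairAvg_mul, pairAvg_mul]
    refine mul_le_mul_of_nonneg_left ?_ (by positivity)
    exact div_le_div_of_nonneg_right (pairSum_shift_le A P k w) (by positivity)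
  have hmass : ip β₂ (fun _ => 1) ≤ 1 := by
    rw [ip_comm, hβ₂, ip_dcv_mu, pairAvg, pairSum_const, one_mul]
    exact div_self_le_one _
  have hswap : ex (fun z => F z * cv β₁ β₂ z) =
      ex (fun w => β₂ w * ip (fun y => F (y + w)) β₁) := by
    simp only [ex, cv, ip]
    congr 1
    have e1 : ∀ z, F z * ((∑ y, β₁ y * β₂ (z - y)) / (Fintype.card G : ℝ)) =
        ∑ y, F z * (β₁ y * β₂ (z - y)) / (Fintype.card G : ℝ) := fun z => by
      rw [mul_div_assoc', Finset.mul_sum, Finset.sum_div]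
    have e2 : ∀ w, β₂ w * ((∑ y, F (y + w) * β₁ y) / (Fintype.card G : ℝ)) =
        ∑ y, F (y + w) * (β₁ y * β₂ w) / (Fintype.card G : ℝ) := fun w => by
      rw [mul_div_assoc', Finset.mul_sum, Finset.sum_div]
      exact Finset.sum_congr rfl fun y _ => by ring
    simp only [e1, e2]
    refine Finset.sum_comm.trans (Eq.trans ?_ Finset.sum_comm)
    refine Finset.sum_congr rfl fun y _ => ?_
    refine (Fintype.sum_equiv (Equiv.addLeft y) _ _ fun w => ?_).symm
    simp
  calc ex (fun z => F z * cv β₁ β₂ z) = ex (fun w => β₂ w * ip (fun y => F (y + w)) β₁) := hswap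
    _ ≤ ex (fun w => β₂ w * pairAvg P P F) := by
      refine div_le_div_of_nonneg_right (Finset.sum_le_sum fun w _ => ?_) (by positivity)
      exact mul_le_mul_of_nonneg_left (hshift w) (hβ₂0 w)
    _ = ip β₂ (fun _ => 1) * pairAvg P P F := by
      simp only [ip, ex, mul_one]
      rw [← Finset.sum_mul, div_mul_eq_mul_div]
    _ ≤ pairAvg P P F := mul_le_of_le_one_left hF0 hmass

/-! ### The iteration -/

/-- The state of the iteration after `n` steps: a dense subset `X` of a regular dilate of `B₁` such
that the average of `normDiff A α` over the differences of `X` is at least `65/64 * 2 ^ n`. -/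
def SiftState (B₁ : Bohr G) (A : Finset G) (α : ℝ) (m n : ℕ) : Prop :=
  ∃ δ : ℝ, (1 / 100 / (2 * B₁.rank) : ℝ) ^ n ≤ δ ∧ (B₁.dilate δ).Regular ∧
    ∃ P X : Finset G, (P : Set G) = (B₁.dilate δ).carrier ∧ X ⊆ P ∧ X.Nonempty ∧
      α ^ (m + 20580 * n) * #P ≤ #X ∧ 65 / 64 * 2 ^ n ≤ pairAvg X X (normDiff A α)

/-- The outcome of the iteration after `n` steps. -/
def SiftOutcome (B₁ : Bohr G) (A : Finset G) (α : ℝ) (m n : ℕ) : Prop :=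
  ∃ δ σ : ℝ, ∃ B'' : Bohr G, (1 / 100 / (2 * B₁.rank) : ℝ) ^ n ≤ δ ∧ (B₁.dilate δ).Regular ∧
    Bohr.subR (1 / 100 / B₁.rank) B'' (B₁.dilate δ) ∧ 65 / 64 * 2 ^ n ≤ σ ∧ σ ≤ 1 / α ∧
    ∃ P Q Y Z : Finset G, ∃ t : G, (P : Set G) = (B₁.dilate δ).carrier ∧ (Q : Set G) = B''.carrier ∧
      Y.Nonempty ∧ Z.Nonempty ∧ Y ⊆ P ∧ (∀ z ∈ Z, z - t ∈ Q) ∧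
      α ^ (m + 20580 * (n + 1)) ≤ #Y / #P ∧ α ^ (m + 20580 * (n + 1)) ≤ #Z / #Q ∧
      pairAvg Y Y (normDiff A α) ≤ 2 ^ 8 * σ ∧ pairAvg Z Z (normDiff A α) ≤ 2 ^ 8 * σ ∧
      pairAvg Y Z (lowSet (normDiff A α) σ) ≤ 1 / 2 ^ 12

lemma siftState_step {B₁ : Bohr G} {A : Finset G} {α : ℝ} {m n : ℕ} (hA : A.Nonempty) (hα : 0 < α)
    (hα1 : α ≤ 32 / 33) (h : SiftState B₁ A α m n) :
    SiftOutcome B₁ A α m n ∨ SiftState B₁ A α m (n + 1) := by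
  obtain ⟨δ, hδ, hreg, P, X, hP, hXP, hX, hXd, hXa⟩ := h
  have hα1' : α ≤ 1 := hα1.trans (by norm_num)
  have hα100 : α ^ 100 ≤ 1 / 16 :=
    (pow_le_pow_left₀ hα.le hα1 100).trans (by norm_num)
  have hP0 : (0 : ℝ) < #P := by exact_mod_cast (hX.mono hXP).card_pos
  have hX0 : (0 : ℝ) < #X := by exact_mod_cast hX.card_pos
  set q : ℝ := 1 / 100 / (2 * B₁.rank) with hq
  have hq0 : 0 ≤ q := by positivity
  have hq1 : q ≤ 1 := by
    rcases Nat.eq_zero_or_pos B₁.rank with h0 | h0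
    · simp [hq, h0]
    · have : (1 : ℝ) ≤ B₁.rank := by exact_mod_cast h0
      rw [hq, div_le_one (by positivity)]
      linarith
  have hδ0 : 0 ≤ δ := (by positivity : 0 ≤ q ^ n).trans hδ
  obtain ⟨τ, hτ⟩ : ∃ τ, pairAvg X X (normDiff A α) = τ := ⟨_, rfl⟩
  rw [hτ] at hXa
  have hτ1 : 1 ≤ τ := by
    have : (1 : ℝ) ≤ 2 ^ n := one_le_pow₀ (by norm_num)
    linarith
  have hτα : τ ≤ 1 / α := by
    rw [← hτ, ← pairAvg_const hX hX (1 / α)]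
    exact pairAvg_le _ _ (normDiff_le hA hα)
  have hexp : α ^ (m + 20580 * (n + 1)) ≤ α ^ 20480 * (1 / 16) * α ^ (m + 20580 * n) := by
    calc α ^ (m + 20580 * (n + 1)) = α ^ 20480 * α ^ 100 * α ^ (m + 20580 * n) := by
          rw [← pow_add, ← pow_add]
          congr 1
          ring
      _ ≤ _ := by gcongr
  rcases sift_dichotomy hA hα hX hτ hτ1 with ⟨Y, hYX, hY, hYc, hYa⟩ | ⟨Y, hYX, hY, hYc, hYa, hYl⟩
  · right
    refine ⟨δ, ?_, hreg, P, Y, hP, hYX.trans hXP, hY, ?_, ?_⟩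
    · refine le_trans ?_ hδ
      exact pow_le_pow_of_le_one hq0 hq1 (Nat.le_succ n)
    · calc α ^ (m + 20580 * (n + 1)) * #P ≤ α ^ (20481 + (m + 20580 * n)) * #P := by
            refine mul_le_mul_of_nonneg_right (pow_le_pow_of_le_one hα.le hα1' ?_) hP0.le
            omega
        _ = α ^ 20481 * (α ^ (m + 20580 * n) * #P) := by rw [pow_add, mul_assoc]
        _ ≤ α ^ 20481 * #X := mul_le_mul_of_nonneg_left hXd (by positivity)
        _ ≤ _ := hYc
    · rw [pow_succ]
      linarith
  obtain ⟨B'', hsub⟩ := Bohr.exists_subR (B₁.dilate δ) (r := 1 / 100) (by norm_num)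
  have hsub' := hsub
  obtain ⟨δ', hδ'1, hδ'2, rfl, hreg'⟩ := hsub
  have hrank : ((B₁.dilate δ).rank : ℝ) = B₁.rank := rfl
  rw [hrank] at hδ'1 hδ'2
  have hδ'0 : 0 ≤ δ' := le_trans (by positivity) hδ'1
  obtain ⟨Q, hQ⟩ : ∃ Q : Finset G, (Q : Set G) = ((B₁.dilate δ).dilate δ').carrier :=
    ⟨(Set.toFinite ((B₁.dilate δ).dilate δ').carrier).toFinset, Set.Finite.coe_toFinset _⟩
  obtain ⟨W, hW⟩ : ∃ W : Finset G, (W : Set G) = ((B₁.dilate δ).dilate (1 + δ')).carrier :=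
    ⟨(Set.toFinite ((B₁.dilate δ).dilate (1 + δ')).carrier).toFinset, Set.Finite.coe_toFinset _⟩
  have hmP : ∀ x, x ∈ P ↔ x ∈ (B₁.dilate δ).carrier := fun x => by rw [← hP, Finset.mem_coe]
  have hmQ : ∀ x, x ∈ Q ↔ x ∈ ((B₁.dilate δ).dilate δ').carrier := fun x => by
    rw [← hQ, Finset.mem_coe]
  have hmW : ∀ x, x ∈ W ↔ x ∈ ((B₁.dilate δ).dilate (1 + δ')).carrier := fun x => by
    rw [← hW, Finset.mem_coe]
  have hQne : Q.Nonempty := by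
    refine ⟨0, (hmQ 0).2 ?_⟩
    obtain ⟨x, hx⟩ := hX.mono hXP
    rcases Bohr.nonneg_radius_or_freq_empty ⟨x, (hmP x).1 hx⟩ with h | h
    · exact Bohr.zero_mem_carrier (mul_nonneg hδ'0 h)
    · intro γ hγ
      exact absurd (h ▸ hγ : γ ∈ (∅ : Finset _)) (Finset.notMem_empty _)
  have hPW : ∀ x ∈ P, ∀ y ∈ Q, x - y ∈ W := by
    intro x hx y hy
    rw [hmW]
    have := Bohr.sub_mem_carrier ((hmP x).1 hx) ((hmQ y).1 hy)
    convert this using 2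
    simp only [Bohr.dilate, Bohr.mk.injEq, true_and]
    ring
  have hdδ : 100 * (B₁.rank : ℝ) * δ' ≤ 1 := by
    rcases Nat.eq_zero_or_pos B₁.rank with h0 | h0
    · simp [h0]
    · have : (0 : ℝ) < B₁.rank := by exact_mod_cast h0
      rw [le_div_iff₀ this] at hδ'2
      linarith
  have hWP : (#W : ℝ) ≤ 2 * #P := by
    have := (hreg δ' (by
      rw [hrank, abs_of_nonneg hδ'0]
      refine hδ'2.trans_eq ?_
      rw [div_div])).2
    rw [← hW, ← hP, natCard_coe, natCard_coe, hrank, abs_of_nonneg hδ'0] at this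
    refine this.trans (mul_le_mul_of_nonneg_right (by linarith) hP0.le)
  obtain ⟨t, Z, hZY, hZ, hZQ, hZd, hZl⟩ := exists_localise hY hQne (hYX.trans hXP) hPW hWP
    (lowSet_nonneg _ _) hYl
  have hQ0 : (0 : ℝ) < #Q := by exact_mod_cast hQne.card_pos
  have hYP : α ^ 20480 / 4 * α ^ (m + 20580 * n) ≤ (#Y / #P : ℝ) := by
    rw [le_div_iff₀ hP0]
    calc α ^ 20480 / 4 * α ^ (m + 20580 * n) * #P
        = α ^ 20480 / 4 * (α ^ (m + 20580 * n) * #P) := by ring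
      _ ≤ α ^ 20480 / 4 * #X := mul_le_mul_of_nonneg_left hXd (by positivity)
      _ ≤ _ := hYc
  have hpos : 0 ≤ α ^ 20480 * α ^ (m + 20580 * n) := by positivity
  have hYP' : α ^ (m + 20580 * (n + 1)) ≤ (#Y / #P : ℝ) := by
    refine hexp.trans (le_trans ?_ hYP)
    linarith
  have hZQ' : α ^ (m + 20580 * (n + 1)) ≤ (#Z / #Q : ℝ) := by
    refine hexp.trans (le_trans ?_ hZd)
    linarith
  rcases le_or_gt (pairAvg Z Z (normDiff A α)) (2 ^ 8 * τ) with hle | hgt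
  · left
    exact ⟨δ, τ, _, hδ, hreg, hsub', hXa, hτα, P, Q, Y, Z, t, hP, hQ, hY, hZ, hYX.trans hXP, hZQ,
      hYP', hZQ', hYa.trans (by linarith), hle, hZl⟩
  · right
    have hdil : (B₁.dilate δ).dilate δ' = B₁.dilate (δ' * δ) := by
      simp only [Bohr.dilate, mul_assoc]
    rw [hdil] at hreg' hQ
    refine ⟨δ' * δ, ?_, hreg', Q, Z.map (addRightEmbedding (-t)), hQ, ?_, ?_, ?_, ?_⟩
    · rw [pow_succ']
      refine mul_le_mul (le_trans (le_of_eq ?_) hδ'1) hδ (by positivity) hδ'0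
      ring
    · intro z hz
      obtain ⟨y, hy, rfl⟩ := Finset.mem_map.1 hz
      simpa [sub_eq_add_neg] using hZQ y hy
    · simpa using hZ
    · rw [Finset.card_map]
      rwa [le_div_iff₀ hQ0] at hZQ'
    · rw [pairAvg_map, pow_succ]
      linarith

lemma exists_siftOutcome {B₁ : Bohr G} {A : Finset G} {α : ℝ} {m : ℕ} (hA : A.Nonempty)
    (hα : 0 < α) (hα1 : α ≤ 32 / 33) (h : SiftState B₁ A α m 0) :
    ∃ n, SiftOutcome B₁ A α m n := by
  by_contra! hcon
  have hall : ∀ n, SiftState B₁ A α m n := fun n => by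
    induction n with
    | zero => exact h
    | succ n ih => exact (siftState_step hA hα hα1 ih).resolve_left (hcon n)
  obtain ⟨n, hn⟩ := pow_unbounded_of_one_lt (1 / α) (one_lt_two (α := ℝ))
  obtain ⟨δ, -, -, P, X, -, -, hX, -, hXa⟩ := hall n
  have : pairAvg X X (normDiff A α) ≤ 1 / α := by
    rw [← pairAvg_const hX hX (1 / α)]
    exact pairAvg_le _ _ (normDiff_le hA hα)
  have h2 : (0 : ℝ) < 2 ^ n := by positivity
  linarith


/-! ### The initial state and the final estimates -/

lemma pow_le_of_le_lpNormWt {f ν : G → ℝ} {p : ℕ} (hp : 1 ≤ p) {c : ℝ} (hc : 0 ≤ c)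
    (hf : ∀ x, 0 ≤ f x) (hν : ∀ x, 0 ≤ ν x) (h : c ≤ lpNormWt p ν f) :
    c ^ p ≤ ex fun x => f x ^ p * ν x := by
  have hE : lpNormWt p ν f = (ex fun x => f x ^ p * ν x) ^ (1 / p : ℝ) := by
    simp only [lpNormWt, Real.rpow_natCast, abs_of_nonneg (hf _)]
  have h0 : 0 ≤ ex fun x => f x ^ p * ν x :=
    div_nonneg (Finset.sum_nonneg fun x _ => mul_nonneg (pow_nonneg (hf x) _) (hν x))
      (by positivity)
  calc c ^ p ≤ ((ex fun x => f x ^ p * ν x) ^ (1 / p : ℝ)) ^ p :=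
        pow_le_pow_left₀ hc (hE ▸ h) p
    _ = _ := by rw [one_div, Real.rpow_inv_natCast_pow h0 (by omega)]

lemma dcv_mu_nonneg (P : Finset G) (z : G) : 0 ≤ dcv (mu (P : Set G)) (mu (P : Set G)) z := by
  rw [dcv_mu_self]
  exact mul_nonneg (by positivity) (diffCount_nonneg P z)

lemma cv_nonneg {f g : G → ℝ} (hf : ∀ x, 0 ≤ f x) (hg : ∀ x, 0 ≤ g x) (z : G) : 0 ≤ cv f g z :=
  div_nonneg (Finset.sum_nonneg fun x _ => mul_nonneg (hf x) (hg _)) (by positivity)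

/-- A large norm of `normDiff A α` with respect to the weight `μ_P ∘ μ_P ∗ μ_Q ∘ μ_Q` gives the
initial state of the iteration. -/
lemma siftState_zero {B₁ : Bohr G} {A P Q : Finset G} {α : ℝ} {p : ℕ} (hA : A.Nonempty)
    (hα : 0 < α) (hreg : B₁.Regular) (hP : (P : Set G) = B₁.carrier) (hp : 1 ≤ p)
    (h : 33 / 32 ≤ lpNormWt p
      (cv (dcv (mu (P : Set G)) (mu (P : Set G))) (dcv (mu (Q : Set G)) (mu (Q : Set G))))
      (normDiff A α)) :
    α ≤ 32 / 33 ∧ SiftState B₁ A α (p + 201) 0 := by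
  have hm := (pow_le_of_le_lpNormWt hp (by norm_num) (normDiff_nonneg hα)
    (cv_nonneg (dcv_mu_nonneg P) (dcv_mu_nonneg Q)) h).trans (ex_pow_mul_cv_le hα p)
  have hPne : P.Nonempty := by
    by_contra hne
    rw [Finset.not_nonempty_iff_eq_empty] at hne
    rw [hne] at hm
    simp only [pairAvg, pairSum, Finset.sum_empty, zero_div] at hm
    have : (0 : ℝ) < (33 / 32) ^ p := by positivity
    linarith
  have hα1 : α ≤ 32 / 33 := by
    have h1 : (33 / 32 : ℝ) ^ p ≤ (1 / α) ^ p := by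
      refine hm.trans ?_
      rw [← pairAvg_const hPne hPne ((1 / α) ^ p)]
      exact pairAvg_le _ _ fun z => pow_le_pow_left₀ (normDiff_nonneg hα z) (normDiff_le hA hα z) p
    have h2 := le_of_pow_le_pow_left₀ (by omega) (by positivity) h1
    rw [le_div_iff₀ hα] at h2
    linarith
  refine ⟨hα1, ?_⟩
  obtain ⟨Y, hYP, hY, hYc, hYa⟩ :=
    exists_sift_of_moment hA hα (hα1.trans (by norm_num)) hPne hp hm
  have hdil : B₁.dilate 1 = B₁ := by simp [Bohr.dilate]
  refine ⟨1, by simp, by rwa [hdil], P, Y, by rwa [hdil], hYP, hY, ?_, by simpa using hYa.le⟩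
  refine le_trans (mul_le_mul_of_nonneg_right ?_ (Nat.cast_nonneg _)) hYc
  have h200 : α ^ 200 ≤ 1 / 128 := (pow_le_pow_left₀ hα.le hα1 200).trans (by norm_num)
  calc α ^ (p + 201 + 20580 * 0) = α ^ (p + 1) * α ^ 200 := by rw [← pow_add]
    _ ≤ α ^ (p + 1) * (1 / 128) := by gcongr
    _ = _ := by ring

lemma half_le_log_two : 1 / 2 ≤ Real.log 2 := by
  have := Real.log_two_gt_d9
  linarith

lemma natCast_le_two_mul_log {σ : ℝ} {n : ℕ} (h : 2 ^ n ≤ σ) : (n : ℝ) ≤ 2 * Real.log σ := by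
  have h1 := Real.log_le_log (by positivity) h
  rw [Real.log_pow] at h1
  nlinarith [half_le_log_two, (Nat.cast_nonneg n : (0 : ℝ) ≤ n)]

lemma rpow_le_pow_siftExponent {α σ : ℝ} {p n : ℕ} (hα : 0 < α) (hα1 : α ≤ 1)
    (hn : 2 ^ n ≤ σ) (hσ : σ ≤ 1 / α) :
    α ^ ((p : ℝ) + 41562 * Lq α) ≤ α ^ (p + 201 + 20580 * (n + 1)) := by
  rw [← Real.rpow_natCast]
  refine Real.rpow_le_rpow_of_exponent_ge hα hα1 ?_
  have h2 : (2 : ℝ) ^ (n + 1) ≤ 2 / α := by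
    rw [pow_succ, div_eq_mul_one_div]
    linarith
  have h3 := natCast_le_two_mul_log h2
  push_cast at h3 ⊢
  rw [Lq]
  linarith [(Nat.cast_nonneg n : (0 : ℝ) ≤ n)]

lemma rpow_le_pow_of_two_pow_le {q σ : ℝ} {n : ℕ} (hq0 : 0 ≤ q) (hq1 : q ≤ 1) (hσ : 1 < σ)
    (hn : 2 ^ n ≤ σ) : q ^ (2 * Real.log σ) ≤ q ^ n := by
  rcases hq0.eq_or_lt with rfl | hq
  · rw [Real.zero_rpow (by have := Real.log_pos hσ; positivity)]
    positivity
  · rw [← Real.rpow_natCast]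
    exact Real.rpow_le_rpow_of_exponent_ge hq hq1 (natCast_le_two_mul_log hn)

lemma pairAvg_indic_eq {Y Z : Finset G} (hY : Y.Nonempty) (hZ : Z.Nonempty) (F : G → ℝ) (τ : ℝ) :
    pairAvg Y Z (indic {x | (1 - 1 / 1024) * τ ≤ F x}) = 1 - pairAvg Y Z (lowSet F τ) := by
  rw [eq_sub_iff_add_eq, ← pairAvg_add]
  refine Eq.trans (congrArg _ (funext fun z => ?_)) (pairAvg_const hY hZ 1)
  simp only [indic, lowSet, Set.mem_ofPred_eq]
  split_ifs <;> linarith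

lemma natCard_image_add_right (S : Set G) (t : G) :
    Nat.card ((fun b => b + t) '' S) = Nat.card S :=
  Nat.card_image_of_injective (add_left_injective t) S

lemma lpNormWt_const_mul {f ν : G → ℝ} {p : ℕ} (hp : 1 ≤ p) {c : ℝ} (hc : 0 ≤ c)
    (hν : ∀ x, 0 ≤ ν x) : lpNormWt p ν (fun x => c * f x) = c * lpNormWt p ν f := by
  have hE : (ex fun x => |c * f x| ^ (p : ℝ) * ν x) =
      c ^ p * ex fun x => |f x| ^ (p : ℝ) * ν x := by
    simp only [ex, Real.rpow_natCast, abs_mul, mul_pow, abs_of_nonneg hc, mul_assoc]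
    rw [← Finset.mul_sum, mul_div_assoc]
  have h0 : 0 ≤ ex fun x => |f x| ^ (p : ℝ) * ν x :=
    div_nonneg (Finset.sum_nonneg fun x _ => mul_nonneg (by positivity) (hν x)) (by positivity)
  rw [lpNormWt, lpNormWt, hE, one_div, Real.mul_rpow (by positivity) h0,
    Real.pow_rpow_inv_natCast hc (by omega)]

/-- Iterated sifting over `ℤ/Nℤ`, relative to a pair of nested Bohr sets. -/
theorem statement8 :
    ∃ c C C' : ℝ, 0 < c ∧
    ∀ (N : ℕ) [NeZero N], Odd N →
    ∀ (B B₁ B₂ : Bohr (ZMod N)) (d : ℕ),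
      B.Regular → B₁.Regular → B₁.rank = d → B₂.rank = d →
      Bohr.subR (c / d) B₂ B₁ →
    ∀ A : Set (ZMod N), A ⊆ B.carrier →
    ∀ α : ℝ, α = relDensity A B.carrier → 0 < α →
    ∀ p : ℕ, 1 ≤ p →
      (1 + (2 : ℝ) ^ (-5 : ℤ)) * B.dens⁻¹ ≤
        lpNormWt p
          (cv (dcv (mu B₁.carrier) (mu B₁.carrier)) (dcv (mu B₂.carrier) (mu B₂.carrier)))
          (dcv (mu A) (mu A)) →
      ∃ σ : ℝ, 1 + (2 : ℝ) ^ (-7 : ℤ) ≤ σ ∧ σ ≤ α⁻¹ ∧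
      ∃ B' B'' : Bohr (ZMod N), B'.Regular ∧ B''.Regular ∧
      ∃ t : ZMod N, ∃ A₁ A₂ : Set (ZMod N), A₁.Nonempty ∧ A₂.Nonempty ∧
        A₁ ⊆ B'.carrier ∧ A₂ ⊆ (fun b => b + t) '' B''.carrier ∧
        1 - (2 : ℝ) ^ (-12 : ℤ) ≤
          ip (dcv (mu A₁) (mu A₂))
            (indic {x | (1 - (2 : ℝ) ^ (-10 : ℤ)) * σ * B.dens⁻¹ ≤ dcv (mu A) (mu A) x}) ∧
        α ^ ((p : ℝ) + C * Lq α) ≤ relDensity A₁ B'.carrier ∧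
        α ^ ((p : ℝ) + C * Lq α) ≤ relDensity A₂ ((fun b => b + t) '' B''.carrier) ∧
        (∃ δ : ℝ, (c / (2 * d)) ^ (C' * Real.log σ) ≤ δ ∧ B' = B₁.dilate δ) ∧
        Bohr.subR (c / d) B'' B' ∧
        ip (dcv (mu A) (mu A)) (dcv (mu A₁) (mu A₁)) ≤ (2 : ℝ) ^ 8 * σ * B.dens⁻¹ ∧
        ip (dcv (mu A) (mu A)) (dcv (mu A₂) (mu A₂)) ≤ (2 : ℝ) ^ 8 * σ * B.dens⁻¹ := by
  refine ⟨1 / 100, 41562, 2, by norm_num, ?_⟩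
  intro N _ _ B B₁ B₂ d _ hB₁ hd _ _ A hAB α hα hα0 p hp hnorm
  subst hd
  obtain ⟨A, rfl⟩ : ∃ A' : Finset (ZMod N), (A' : Set (ZMod N)) = A :=
    ⟨(Set.toFinite A).toFinset, Set.Finite.coe_toFinset _⟩
  obtain ⟨K, hK⟩ : ∃ K : Finset (ZMod N), (K : Set (ZMod N)) = B.carrier :=
    ⟨(Set.toFinite B.carrier).toFinset, Set.Finite.coe_toFinset _⟩
  obtain ⟨P₀, hP₀⟩ : ∃ P : Finset (ZMod N), (P : Set (ZMod N)) = B₁.carrier :=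
    ⟨(Set.toFinite B₁.carrier).toFinset, Set.Finite.coe_toFinset _⟩
  obtain ⟨Q₀, hQ₀⟩ : ∃ Q : Finset (ZMod N), (Q : Set (ZMod N)) = B₂.carrier :=
    ⟨(Set.toFinite B₂.carrier).toFinset, Set.Finite.coe_toFinset _⟩
  rw [relDensity, ← hK, natCard_coe, natCard_coe] at hα
  have hA0 : (0 : ℝ) < #A := by
    refine lt_of_le_of_ne (by positivity) fun h => ?_
    rw [hα, ← h, zero_div] at hα0
    exact lt_irrefl _ hα0
  have hK0 : (0 : ℝ) < #K := by
    refine lt_of_le_of_ne (by positivity) fun h => ?_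
    rw [hα, ← h, div_zero] at hα0
    exact lt_irrefl _ hα0
  have hA : A.Nonempty := Finset.card_pos.1 (by exact_mod_cast hA0)
  have hG : (0 : ℝ) < Fintype.card (ZMod N) := by exact_mod_cast Fintype.card_pos
  have hdens : B.dens⁻¹ = Fintype.card (ZMod N) / #K := by
    rw [Bohr.dens, ← hK, natCard_coe, Nat.card_eq_fintype_card, inv_div]
  have hdens0 : 0 < B.dens⁻¹ := by rw [hdens]; positivity
  have hD : dcv (mu (A : Set (ZMod N))) (mu (A : Set (ZMod N))) =
      fun z => B.dens⁻¹ * normDiff A α z := by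
    funext z
    rw [dcv_mu_self, hdens, normDiff, hα]
    field_simp
  have hnorm' : 33 / 32 ≤ lpNormWt p
      (cv (dcv (mu (P₀ : Set (ZMod N))) (mu (P₀ : Set (ZMod N))))
        (dcv (mu (Q₀ : Set (ZMod N))) (mu (Q₀ : Set (ZMod N))))) (normDiff A α) := by
    rw [hD, ← hP₀, ← hQ₀, lpNormWt_const_mul hp hdens0.le
      (cv_nonneg (dcv_mu_nonneg P₀) (dcv_mu_nonneg Q₀)), mul_comm] at hnorm
    refine le_trans (le_of_eq ?_) (le_of_mul_le_mul_left hnorm hdens0)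
    norm_num
  obtain ⟨hα1, h0⟩ := siftState_zero hA hα0 hB₁ hP₀ hp hnorm'
  obtain ⟨n, δ, σ, B'', hδ, hreg, hsub, hσ1, hσ2, P, Q, Y, Z, t, hP, hQ, hY, hZ, hYP, hZQ, hYd,
    hZd, hYa, hZa, hlow⟩ := exists_siftOutcome hA hα0 hα1 h0
  have hn : (2 : ℝ) ^ n ≤ σ := by
    have : (0 : ℝ) < 2 ^ n := by positivity
    linarith
  have hσ : (65 / 64 : ℝ) ≤ σ := by
    have : (1 : ℝ) ≤ 2 ^ n := one_le_pow₀ (by norm_num)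
    linarith
  have hexp := rpow_le_pow_siftExponent (p := p) hα0 (hα1.trans (by norm_num)) hn hσ2
  have henergy : ∀ W : Finset (ZMod N), pairAvg W W (normDiff A α) ≤ 2 ^ 8 * σ →
      ip (dcv (mu (A : Set (ZMod N))) (mu (A : Set (ZMod N))))
        (dcv (mu (W : Set (ZMod N))) (mu (W : Set (ZMod N)))) ≤ (2 : ℝ) ^ 8 * σ * B.dens⁻¹ := by
    intro W hW
    rw [ip_dcv_mu, hD, pairAvg_mul, mul_comm]
    exact mul_le_mul_of_nonneg_right hW hdens0.le
  refine ⟨σ, le_trans (by norm_num) hσ, by rwa [inv_eq_one_div], B₁.dilate δ, B'', hreg,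
    hsub.choose_spec.2.2.2, t, Y, Z, hY, hZ, ?_, ?_, ?_, ?_, ?_, ⟨δ, ?_, rfl⟩, hsub,
    henergy Y hYa, henergy Z hZa⟩
  · rw [← hP]
    exact_mod_cast hYP
  · intro z hz
    refine ⟨z - t, ?_, sub_add_cancel z t⟩
    rw [← hQ]
    exact hZQ z hz
  · have hS : {x | (1 - (2 : ℝ) ^ (-10 : ℤ)) * σ * B.dens⁻¹ ≤
        dcv (mu (A : Set (ZMod N))) (mu (A : Set (ZMod N))) x} =
        {x | (1 - 1 / 1024) * σ ≤ normDiff A α x} := by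
      ext x
      rw [Set.mem_ofPred_eq, Set.mem_ofPred_eq, hD, mul_comm, mul_le_mul_iff_right₀ hdens0]
      norm_num
    rw [hS, ip_comm, ip_dcv_mu, pairAvg_indic_eq hY hZ]
    refine le_trans (le_of_eq ?_) (sub_le_sub_left hlow 1)
    norm_num
  · refine hexp.trans ?_
    rwa [relDensity, ← hP, natCard_coe, natCard_coe]
  · refine hexp.trans ?_
    rwa [relDensity, natCard_image_add_right, ← hQ, natCard_coe, natCard_coe]
  · refine le_trans (rpow_le_pow_of_two_pow_le (by positivity) ?_ (by linarith) hn) hδ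
    rcases Nat.eq_zero_or_pos B₁.rank with hd | hd
    · simp [hd]
    · have : (1 : ℝ) ≤ B₁.rank := by exact_mod_cast hd
      rw [div_le_one (by positivity)]
      linarith

end Formal
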